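/- arXiv:1612.05554 — 3 statements merged into one kernel-verified Lean document; each statement's English description precedes it below -/
import Mathlib

section
/- Let E be a CPTP map on the d×d complex matrices and let λ ∈ (0,1). Define Ẽ = (1−λ)E + λ·Id. Then for every matrix X the iterates Ẽ^n(X) converge as n → ∞, and the limit equals E_∞(X), where E_∞ = lim_{T→∞} (1/T) Σ_{i=0}^{T−1} E^i is the Cesàro-mean projection of E. In particular, lim_n Ẽ^n is an idempotent CPTP map whose fixed-point set and range both equal fix(E). -/
open Matrix Filter
open scoped ComplexOrder

/-- A map on `d × d` complex matrices is CPTP if it admits a Kraus (operator-sum)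
representation `E(X) = ∑ k, M k * X * (M k)ᴴ` with `∑ k, (M k)ᴴ * M k = 1`. -/
def IsCPTP {d : ℕ} (E : Matrix (Fin d) (Fin d) ℂ → Matrix (Fin d) (Fin d) ℂ) : Prop :=
  ∃ (m : ℕ) (M : Fin m → Matrix (Fin d) (Fin d) ℂ),
    (∀ X, E X = ∑ k, M k * X * (M k)ᴴ) ∧ (∑ k, (M k)ᴴ * M k = 1)

section Abstract

theorem tendsto_zero_of_contract (a e : ℕ → ℝ) (r : ℝ) (h0 : ∀ n, 0 ≤ a n) (hr0 : 0 ≤ r)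
    (hr : r < 1) (h : ∀ n, a (n+1) ≤ r * a n + e n) (he : Tendsto e atTop (nhds 0)) :
    Tendsto a atTop (nhds 0) := by
  rw [Metric.tendsto_atTop]
  intro ε hε
  have h1 : 0 < (ε/2) * (1 - r) := by
    have : 0 < 1 - r := by linarith
    positivity
  obtain ⟨N, hN⟩ := (eventually_atTop.1 (he.eventually_lt_const h1))
  have key : ∀ k, a (N + k) ≤ ε/2 + r^k * a N := by
    intro k
    induction k with
    | zero => simp; linarith
    | succ k ih =>
      have h2 := h (N+k)
      have h3 := hN (N+k) (by omega)
      have h4 := mul_le_mul_of_nonneg_left ih hr0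
      rw [← add_assoc, pow_succ]
      nlinarith
  have h5 : Tendsto (fun k => r^k * a N) atTop (nhds 0) := by
    simpa using (tendsto_pow_atTop_nhds_zero_of_lt_one hr0 hr).mul_const (a N)
  obtain ⟨K, hK⟩ := (eventually_atTop.1 (h5.eventually_lt_const (half_pos hε)))
  refine ⟨N + K, fun n hn => ?_⟩
  obtain ⟨k, rfl⟩ := Nat.exists_eq_add_of_le (show N ≤ n by omega)
  have h6 := key k
  have h7 := hK k (by omega)
  rw [Real.dist_eq, sub_zero, abs_of_nonneg (h0 _)]
  linarith

theorem norm_lazy_lt {lam : ℝ} (h0 : 0 < lam) (h1 : lam < 1) {μ : ℂ} (hμ : ‖μ‖ ≤ 1) (hne : μ ≠ 1) :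
    ‖((1 - lam : ℝ) : ℂ) * μ + (lam : ℂ)‖ < 1 := by
  have hsq : μ.re * μ.re + μ.im * μ.im ≤ 1 := by
    have := Complex.normSq_eq_norm_sq μ
    rw [Complex.normSq_apply] at this
    rw [this]; nlinarith [norm_nonneg μ]
  have hre : μ.re < 1 := by
    by_contra hcon
    push Not at hcon
    apply hne
    have him : μ.im = 0 := by nlinarith [mul_self_nonneg μ.im]
    have : μ.re = 1 := by nlinarith [mul_self_nonneg μ.im]
    exact Complex.ext (by simpa using this) (by simpa using him)
  have : ‖((1 - lam : ℝ) : ℂ) * μ + (lam : ℂ)‖ ^ 2 < 1 := by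
    rw [← Complex.normSq_eq_norm_sq, Complex.normSq_apply]
    simp only [Complex.add_re, Complex.add_im, Complex.re_ofReal_mul, Complex.im_ofReal_mul,
      Complex.ofReal_re, Complex.ofReal_im]
    have h2 : 0 < lam * (1 - lam) := mul_pos h0 (by linarith)
    nlinarith [mul_pos h2 (sub_pos.2 hre), mul_nonneg (sq_nonneg (1-lam)) (sub_nonneg.2 hsq)]
  nlinarith [norm_nonneg (((1 - lam : ℝ) : ℂ) * μ + (lam : ℂ))]

variable {V : Type*} [NormedAddCommGroup V] [NormedSpace ℂ V]

theorem fixed_range_zero (L : Module.End ℂ V) (hb : ∀ x, ∃ C : ℝ, ∀ n : ℕ, ‖(L ^ n) x‖ ≤ C)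
    (x y : V) (hy : L y = y) (hx : L x = x + y) : y = 0 := by
  obtain ⟨C, hC⟩ := hb x
  have key : ∀ n : ℕ, (L ^ n) x = x + (n : ℂ) • y := by
    intro n
    induction n with
    | zero => simp
    | succ n ih =>
      rw [pow_succ', Module.End.mul_apply, ih, map_add, map_smul, hy, hx]
      push_cast
      module
  by_contra hne
  have hpos : 0 < ‖y‖ := norm_pos_iff.2 hne
  obtain ⟨n, hn⟩ := exists_nat_gt ((C + ‖x‖) / ‖y‖)
  rw [div_lt_iff₀ hpos] at hn
  have h1 := hC n
  rw [key] at h1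
  have h2 : ‖(n : ℂ) • y‖ ≤ ‖x + (n : ℂ) • y‖ + ‖x‖ := by
    have := norm_sub_le (x + (n : ℂ) • y) x
    simpa using this
  rw [norm_smul, Complex.norm_natCast] at h2
  linarith

theorem eig_large_zero (L : Module.End ℂ V) (hb : ∀ x, ∃ C : ℝ, ∀ n : ℕ, ‖(L ^ n) x‖ ≤ C)
    (μ : ℂ) (hμ : 1 < ‖μ‖) (x : V) (hx : L x = μ • x) : x = 0 := by
  obtain ⟨C, hC⟩ := hb x
  have key : ∀ n : ℕ, (L ^ n) x = μ ^ n • x := by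
    intro n
    induction n with
    | zero => simp
    | succ n ih =>
      rw [pow_succ', Module.End.mul_apply, ih, map_smul, hx, smul_smul, pow_succ]
  by_contra hne
  have hpos : 0 < ‖x‖ := norm_pos_iff.2 hne
  obtain ⟨n, hn⟩ := pow_unbounded_of_one_lt (C / ‖x‖) hμ
  rw [div_lt_iff₀ hpos] at hn
  have h1 := hC n
  rw [key, norm_smul, norm_pow] at h1
  linarith

/-- Property of a vector: it splits with lazy iterates converging to the fixed part. -/
def LazyGood (L F : Module.End ℂ V) (x : V) : Prop :=
  ∃ y z, L y = y ∧ x = y + (L z - z) ∧ Tendsto (fun n : ℕ => (F ^ n) x) atTop (nhds y)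

theorem lazyGood_of_gen (L : Module.End ℂ V) (hb : ∀ x, ∃ C : ℝ, ∀ n : ℕ, ‖(L ^ n) x‖ ≤ C)
    {lam : ℝ} (h0 : 0 < lam) (h1 : lam < 1) (F : Module.End ℂ V)
    (hF : ∀ x, F x = ((1 - lam : ℝ) : ℂ) • L x + ((lam : ℝ) : ℂ) • x)
    (μ : ℂ) (k : ℕ) : ∀ x, ((L - μ • (1 : Module.End ℂ V)) ^ k) x = 0 → LazyGood L F x := by
  have hstep : ∀ k x, ((L - μ • (1 : Module.End ℂ V)) ^ (k+1)) x = 0 →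
      ((L - μ • (1 : Module.End ℂ V)) ^ k) (L x - μ • x) = 0 := by
    intro k x hx
    rw [pow_succ, Module.End.mul_apply] at hx
    simpa using hx
  by_cases hμ1 : μ = 1
  · subst hμ1
    have key : ∀ k x, ((L - (1:ℂ) • (1 : Module.End ℂ V)) ^ k) x = 0 → L x = x := by
      intro k
      induction k with
      | zero => intro x hx; simp at hx; simp [hx]
      | succ k ih =>
        intro x hx
        have h2 := ih _ (hstep k x hx)
        have := fixed_range_zero L hb x _ h2 (by module)
        rw [one_smul, sub_eq_zero] at this
        exact this
    intro x hx
    have hx' := key k x hx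
    refine ⟨x, 0, hx', by simp, ?_⟩
    have hFx : F x = x := by rw [hF, hx', ← add_smul]; simp
    have : ∀ n : ℕ, (F ^ n) x = x := by
      intro n
      induction n with
      | zero => simp
      | succ n ih => rw [pow_succ, Module.End.mul_apply, hFx, ih]
    simp [this]
  · by_cases hμ : 1 < ‖μ‖
    · have key : ∀ k x, ((L - μ • (1 : Module.End ℂ V)) ^ k) x = 0 → x = 0 := by
        intro k
        induction k with
        | zero => intro x hx; simpa using hx
        | succ k ih =>
          intro x hx
          exact eig_large_zero L hb μ hμ x (sub_eq_zero.1 (ih _ (hstep k x hx)))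
      intro x hx
      rw [key k x hx]
      exact ⟨0, 0, by simp, by simp, by simp⟩
    · push Not at hμ
      have hν := norm_lazy_lt h0 h1 hμ hμ1
      set ν := ((1 - lam : ℝ) : ℂ) * μ + (lam : ℂ) with hνdef
      have key : ∀ k x, ((L - μ • (1 : Module.End ℂ V)) ^ k) x = 0 →
          (∃ z, x = L z - z) ∧ Tendsto (fun n : ℕ => (F ^ n) x) atTop (nhds 0) := by
        intro k
        induction k with
        | zero => intro x hx; simp at hx; subst hx; exact ⟨⟨0, by simp⟩, by simp⟩
        | succ k ih =>
          intro x hx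
          obtain ⟨⟨z, hz⟩, hlim⟩ := ih _ (hstep k x hx)
          constructor
          · refine ⟨(μ - 1)⁻¹ • (x - z), ?_⟩
            have hm : μ - 1 ≠ 0 := sub_ne_zero.2 hμ1
            have h3 : (μ - 1) • x = (L x - L z) - (x - z) := by
              rw [sub_smul, one_smul]
              have : μ • x = L x - (L z - z) := by rw [← hz]; abel
              rw [this]; abel
            rw [map_smul, map_sub, ← smul_sub, ← h3, smul_smul, inv_mul_cancel₀ hm, one_smul]
          · rw [tendsto_zero_iff_norm_tendsto_zero]
            refine tendsto_zero_of_contract _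
              (fun n => ‖((1 - lam : ℝ) : ℂ)‖ * ‖(F ^ n) (L x - μ • x)‖) ‖ν‖
              (fun n => norm_nonneg _) (norm_nonneg _) hν ?_ ?_
            · intro n
              have h4 : F x = ν • x + ((1 - lam : ℝ) : ℂ) • (L x - μ • x) := by
                rw [hF, hνdef]; module
              rw [pow_succ, Module.End.mul_apply, h4, map_add, map_smul, map_smul,
                ← norm_smul, ← norm_smul]
              exact norm_add_le _ _
            · simpa using (hlim.norm.const_mul ‖((1 - lam : ℝ) : ℂ)‖)
      intro x hx
      obtain ⟨⟨z, hz⟩, hl⟩ := key k x hx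
      exact ⟨0, z, by simp, by simpa using hz, hl⟩

theorem lazyGood_all [FiniteDimensional ℂ V] (L : Module.End ℂ V)
    (hb : ∀ x, ∃ C : ℝ, ∀ n : ℕ, ‖(L ^ n) x‖ ≤ C)
    {lam : ℝ} (h0 : 0 < lam) (h1 : lam < 1) (F : Module.End ℂ V)
    (hF : ∀ x, F x = ((1 - lam : ℝ) : ℂ) • L x + ((lam : ℝ) : ℂ) • x) (x : V) :
    LazyGood L F x := by
  have hx : x ∈ ⨆ μ : ℂ, L.maxGenEigenspace μ := by
    rw [Module.End.iSup_maxGenEigenspace_eq_top]; trivial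
  refine Submodule.iSup_induction _ (motive := LazyGood L F) hx ?_ ?_ ?_
  · intro μ x hx
    rw [Module.End.mem_maxGenEigenspace] at hx
    obtain ⟨k, hk⟩ := hx
    exact lazyGood_of_gen L hb h0 h1 F hF μ k x hk
  · exact ⟨0, 0, by simp, by simp, by simp⟩
  · rintro a b ⟨y, z, hy, ha, hl⟩ ⟨y', z', hy', hb, hl'⟩
    refine ⟨y + y', z + z', by rw [map_add, hy, hy'], ?_, ?_⟩
    · rw [ha, hb, map_add]; abel
    · simpa using hl.add hl'

theorem cesaro_tendsto (L : Module.End ℂ V)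
    (hb : ∀ x, ∃ C : ℝ, ∀ n : ℕ, ‖(L ^ n) x‖ ≤ C) (y z : V) (hy : L y = y) :
    Tendsto (fun T : ℕ => (T : ℂ)⁻¹ • ∑ i ∈ Finset.range T, (L ^ i) (y + (L z - z))) atTop
      (nhds y) := by
  obtain ⟨C, hC⟩ := hb z
  have hyn : ∀ n : ℕ, (L ^ n) y = y := by
    intro n
    induction n with
    | zero => simp
    | succ n ih => rw [pow_succ, Module.End.mul_apply, hy, ih]
  have hsum : ∀ T : ℕ, ∑ i ∈ Finset.range T, (L ^ i) (y + (L z - z)) =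
      (T : ℂ) • y + ((L ^ T) z - z) := by
    intro T
    induction T with
    | zero => simp
    | succ T ih =>
      rw [Finset.sum_range_succ, ih, map_add, map_sub, hyn, ← Module.End.mul_apply, ← pow_succ]
      push_cast
      module
  have h2 : Tendsto (fun T : ℕ => (T : ℂ)⁻¹ • ((L ^ T) z - z)) atTop (nhds 0) := by
    have hlim : Tendsto (fun T : ℕ => (T : ℝ)⁻¹ * (C + ‖z‖)) atTop (nhds 0) := by
      simpa using tendsto_inv_atTop_nhds_zero_nat (𝕜 := ℝ) |>.mul_const (C + ‖z‖)
    refine squeeze_zero_norm (fun T => ?_) hlim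
    rw [norm_smul, norm_inv, Complex.norm_natCast]
    gcongr
    exact (norm_sub_le _ _).trans (by gcongr; exact hC T)
  have h3 : Tendsto (fun T : ℕ => y + (T : ℂ)⁻¹ • ((L ^ T) z - z)) atTop (nhds y) := by
    simpa using h2.const_add y
  refine h3.congr' ?_
  filter_upwards [eventually_gt_atTop 0] with T hT
  rw [hsum, smul_add, smul_smul, inv_mul_cancel₀ (by exact_mod_cast hT.ne'), one_smul]

end Abstract

section MatrixPart

variable {d : ℕ}

theorem sum_swap_three {α β γ R : Type*} [Fintype α] [Fintype β] [Fintype γ] [AddCommMonoid R]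
    (f : α → β → γ → R) : ∑ k, ∑ b, ∑ a, f k b a = ∑ a, ∑ b, ∑ k, f k b a := by
  rw [Finset.sum_comm]
  conv_rhs => rw [Finset.sum_comm]
  exact Finset.sum_congr rfl fun b _ => Finset.sum_comm

theorem IsCPTP.comp {E G : Matrix (Fin d) (Fin d) ℂ → Matrix (Fin d) (Fin d) ℂ}
    (hE : IsCPTP E) (hG : IsCPTP G) : IsCPTP (fun X => E (G X)) := by
  obtain ⟨m, M, hM, hM1⟩ := hE
  obtain ⟨l, N, hN, hN1⟩ := hG
  refine ⟨m * l, fun k => M (finProdFinEquiv.symm k).1 * N (finProdFinEquiv.symm k).2, ?_, ?_⟩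
  · intro X
    rw [Equiv.sum_comp finProdFinEquiv.symm (fun p : Fin m × Fin l =>
      M p.1 * N p.2 * X * (M p.1 * N p.2)ᴴ), Fintype.sum_prod_type]
    change E (G X) = _
    rw [hM, hN]
    refine Finset.sum_congr rfl fun i _ => ?_
    rw [Matrix.mul_sum, Matrix.sum_mul]
    refine Finset.sum_congr rfl fun j _ => ?_
    simp only [conjTranspose_mul, Matrix.mul_assoc]
  · rw [Equiv.sum_comp finProdFinEquiv.symm (fun p : Fin m × Fin l =>
      (M p.1 * N p.2)ᴴ * (M p.1 * N p.2)), Fintype.sum_prod_type_right, ← hN1]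
    refine Finset.sum_congr rfl fun j _ => ?_
    have : ∀ i, (M i * N j)ᴴ * (M i * N j) = (N j)ᴴ * ((M i)ᴴ * M i) * N j := by
      intro i; simp only [conjTranspose_mul, Matrix.mul_assoc]
    simp only [this]
    rw [← Matrix.sum_mul, ← Matrix.mul_sum, hM1, Matrix.mul_one]

theorem IsCPTP.iterate {E : Matrix (Fin d) (Fin d) ℂ → Matrix (Fin d) (Fin d) ℂ}
    (hE : IsCPTP E) (n : ℕ) : IsCPTP (E^[n]) := by
  induction n with
  | zero => exact ⟨1, fun _ => 1, by simp, by simp⟩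
  | succ n ih =>
    rw [Function.iterate_succ]
    exact ih.comp hE

theorem IsCPTP.entry_bound {E : Matrix (Fin d) (Fin d) ℂ → Matrix (Fin d) (Fin d) ℂ}
    (hE : IsCPTP E) (X : Matrix (Fin d) (Fin d) ℂ) (i j : Fin d) :
    ‖E X i j‖ ≤ ∑ a, ∑ b, ‖X a b‖ := by
  obtain ⟨m, M, hM, hM1⟩ := hE
  have hcol : ∀ a, ∑ k, ∑ i, ‖M k i a‖ ^ 2 = 1 := by
    intro a
    have h := congrFun (congrFun hM1 a) a
    rw [Matrix.sum_apply] at h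
    simp only [Matrix.mul_apply, conjTranspose_apply, Matrix.one_apply_eq] at h
    have h2 : ((∑ k, ∑ i, ‖M k i a‖ ^ 2 : ℝ) : ℂ) = 1 := by
      rw [← h]; push_cast
      refine Finset.sum_congr rfl fun k _ => Finset.sum_congr rfl fun i _ => ?_
      rw [RCLike.star_def, RCLike.conj_mul]; norm_cast
    exact_mod_cast h2
  have hrow : ∀ i a, ∑ k, ‖M k i a‖ ^ 2 ≤ 1 := by
    intro i a
    rw [← hcol a]
    refine Finset.sum_le_sum fun k _ => ?_
    exact Finset.single_le_sum (f := fun i => ‖M k i a‖ ^ 2) (fun _ _ => by positivity)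
      (Finset.mem_univ i)
  have hexp : E X i j = ∑ k, ∑ b, ∑ a, M k i a * X a b * star (M k j b) := by
    rw [hM, Matrix.sum_apply]
    refine Finset.sum_congr rfl fun k _ => ?_
    rw [Matrix.mul_apply]
    refine Finset.sum_congr rfl fun b _ => ?_
    rw [Matrix.mul_apply, Finset.sum_mul]
    rfl
  calc ‖E X i j‖ ≤ ∑ k, ∑ b, ∑ a, ‖M k i a‖ * ‖X a b‖ * ‖M k j b‖ := by
        rw [hexp]
        refine (norm_sum_le _ _).trans (Finset.sum_le_sum fun k _ => ?_)
        refine (norm_sum_le _ _).trans (Finset.sum_le_sum fun b _ => ?_)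
        refine (norm_sum_le _ _).trans (Finset.sum_le_sum fun a _ => ?_)
        rw [norm_mul, norm_mul, norm_star]
    _ ≤ ∑ k, ∑ b, ∑ a, ‖X a b‖ * ((‖M k i a‖ ^ 2 + ‖M k j b‖ ^ 2) / 2) := by
        refine Finset.sum_le_sum fun k _ => Finset.sum_le_sum fun b _ =>
          Finset.sum_le_sum fun a _ => ?_
        nlinarith [mul_nonneg (norm_nonneg (X a b)) (sq_nonneg (‖M k i a‖ - ‖M k j b‖))]
    _ = ∑ a, ∑ b, ‖X a b‖ * ((∑ k, ‖M k i a‖ ^ 2 + ∑ k, ‖M k j b‖ ^ 2) / 2) := by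
        rw [sum_swap_three]
        refine Finset.sum_congr rfl fun a _ => Finset.sum_congr rfl fun b _ => ?_
        rw [← Finset.mul_sum, ← Finset.sum_div, Finset.sum_add_distrib]
    _ ≤ ∑ a, ∑ b, ‖X a b‖ := by
        refine Finset.sum_le_sum fun a _ => Finset.sum_le_sum fun b _ => ?_
        refine mul_le_of_le_one_right (norm_nonneg _) ?_
        have := hrow i a
        have := hrow j b
        linarith

/-- The Choi matrix of a map. -/
def choi (E : Matrix (Fin d) (Fin d) ℂ → Matrix (Fin d) (Fin d) ℂ) :
    Matrix (Fin d × Fin d) (Fin d × Fin d) ℂ :=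
  fun p q => E (Matrix.single p.2 q.2 1) p.1 q.1

theorem IsCPTP.choi_psd {E : Matrix (Fin d) (Fin d) ℂ → Matrix (Fin d) (Fin d) ℂ}
    (hE : IsCPTP E) : (choi E).PosSemidef := by
  obtain ⟨m, M, hM, hM1⟩ := hE
  have : choi E = ∑ k, vecMulVec (fun p : Fin d × Fin d => M k p.1 p.2)
      (star (fun p : Fin d × Fin d => M k p.1 p.2)) := by
    ext p q
    simp only [choi, hM, Matrix.sum_apply, vecMulVec_apply, Pi.star_apply]
    refine Finset.sum_congr rfl fun k _ => ?_
    simp [Matrix.mul_apply, Matrix.single_apply, ite_and, Finset.sum_ite_eq]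
  rw [this]
  exact posSemidef_sum _ fun k _ => posSemidef_vecMulVec_self_star _

theorem IsCPTP.trace_eq {E : Matrix (Fin d) (Fin d) ℂ → Matrix (Fin d) (Fin d) ℂ}
    (hE : IsCPTP E) (X : Matrix (Fin d) (Fin d) ℂ) : (E X).trace = X.trace := by
  obtain ⟨m, M, hM, hM1⟩ := hE
  rw [hM, Matrix.trace_sum]
  have : ∀ k, (M k * X * (M k)ᴴ).trace = ((M k)ᴴ * M k * X).trace := by
    intro k
    rw [Matrix.trace_mul_comm, Matrix.mul_assoc]
  simp only [this]
  rw [← Matrix.trace_sum, ← Matrix.sum_mul, hM1, Matrix.one_mul]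

open scoped MatrixOrder in
theorem psd_exists_factor {n : Type*} [Fintype n] [DecidableEq n] (A : Matrix n n ℂ)
    (hA : A.PosSemidef) : ∃ B : Matrix n n ℂ, A = Bᴴ * B := by
  refine ⟨CFC.sqrt A, ?_⟩
  have h0 : 0 ≤ A := nonneg_iff_posSemidef.2 hA
  have h1 : (CFC.sqrt A).PosSemidef := nonneg_iff_posSemidef.1 (CFC.sqrt_nonneg A)
  rw [h1.1.eq, CFC.sqrt_mul_sqrt_self A h0]

theorem isCPTP_of_choi (L : Module.End ℂ (Matrix (Fin d) (Fin d) ℂ))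
    (hpsd : (choi L).PosSemidef) (htr : ∀ X, (L X).trace = X.trace) : IsCPTP L := by
  obtain ⟨B, hB⟩ := psd_exists_factor _ hpsd
  let N : Fin d × Fin d → Matrix (Fin d) (Fin d) ℂ := fun p i a => star (B p (i, a))
  have hN : ∀ a b i j, L (Matrix.single a b 1) i j = ∑ p, N p i a * star (N p j b) := by
    intro a b i j
    have := congrFun (congrFun hB (i, a)) (j, b)
    simp only [choi, Matrix.mul_apply, conjTranspose_apply] at this
    rw [this]
    simp [N]
  refine ⟨d * d, fun k => N (finProdFinEquiv.symm k), ?_, ?_⟩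
  · intro X
    rw [Equiv.sum_comp finProdFinEquiv.symm (fun p => N p * X * (N p)ᴴ)]
    ext i j
    conv_lhs => rw [matrix_eq_sum_single X]
    have h1 : ∀ a b, Matrix.single a b (X a b) = X a b • Matrix.single a b (1 : ℂ) := by
      intro a b; simp
    simp only [h1, map_sum, map_smul, Matrix.sum_apply, Matrix.smul_apply, hN, smul_eq_mul]
    simp only [Matrix.mul_apply, conjTranspose_apply, Finset.mul_sum, Finset.sum_mul]
    rw [sum_swap_three]
    refine Finset.sum_congr rfl fun a _ => Finset.sum_congr rfl fun b _ =>
      Finset.sum_congr rfl fun p _ => ?_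
    ring
  · rw [Equiv.sum_comp finProdFinEquiv.symm (fun p => (N p)ᴴ * N p)]
    ext b a
    have h1 := htr (Matrix.single a b 1)
    simp only [Matrix.trace, Matrix.diag_apply, hN] at h1
    rw [Finset.sum_comm] at h1
    simp only [Matrix.sum_apply, Matrix.mul_apply, conjTranspose_apply]
    simp only [mul_comm (star _)]
    rw [h1]
    simp [Matrix.single_apply, Matrix.one_apply, ite_and]

theorem posSemidef_of_tendsto {n : Type*} [Fintype n] (A : ℕ → Matrix n n ℂ) (B : Matrix n n ℂ)
    (hA : ∀ k, (A k).PosSemidef) (h : ∀ i j, Tendsto (fun k => A k i j) atTop (nhds (B i j))) :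
    B.PosSemidef := by
  refine .of_dotProduct_mulVec_nonneg ?_ fun x => ?_
  · ext i j
    rw [conjTranspose_apply]
    refine tendsto_nhds_unique (h j i).star ((h i j).congr fun k => ?_)
    exact ((hA k).1.apply i j).symm
  · have ht : Tendsto (fun k => star x ⬝ᵥ (A k *ᵥ x)) atTop (nhds (star x ⬝ᵥ (B *ᵥ x))) := by
      simp only [dotProduct, mulVec]
      exact tendsto_finsetSum _ fun i _ => (tendsto_finsetSum _ fun j _ =>
        (h i j).mul_const _).const_mul _
    exact ge_of_tendsto' ht fun k => (hA k).dotProduct_mulVec_nonneg x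

open scoped Matrix.Norms.Elementwise in
theorem matrix_main (L F : Module.End ℂ (Matrix (Fin d) (Fin d) ℂ)) (hL : IsCPTP L)
    {lam : ℝ} (h0 : 0 < lam) (h1 : lam < 1)
    (hF : ∀ x, F x = ((1 - lam : ℝ) : ℂ) • L x + ((lam : ℝ) : ℂ) • x)
    (X : Matrix (Fin d) (Fin d) ℂ) :
    ∃ Y, L Y = Y ∧
      Tendsto (fun T : ℕ => (T : ℂ)⁻¹ • ∑ i ∈ Finset.range T, (L ^ i) X) atTop (nhds Y) ∧
      Tendsto (fun n : ℕ => (F ^ n) X) atTop (nhds Y) := by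
  have hb : ∀ x, ∃ C : ℝ, ∀ n : ℕ, ‖(L ^ n) x‖ ≤ C := by
    intro x
    refine ⟨∑ a, ∑ b, ‖x a b‖, fun n => ?_⟩
    rw [Matrix.norm_le_iff (by positivity)]
    intro i j
    rw [Module.End.pow_apply]
    exact (hL.iterate n).entry_bound x i j
  obtain ⟨y, z, hy, hX, hl⟩ := lazyGood_all L hb h0 h1 F hF X
  refine ⟨y, hy, ?_, hl⟩
  have := cesaro_tendsto L hb y z hy
  rwa [← hX] at this

end MatrixPart

/-- For a CPTP map `E` and `λ ∈ (0,1)`, define `Ẽ = (1-λ)E + λ·Id`. Then the iterates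
`Ẽⁿ(X)` converge, and the limit equals the Cesàro-mean projection `E∞(X)` of `E`;
in particular `lim Ẽⁿ` is an idempotent CPTP map with fixed-point set and range both
equal to `fix(E)`. -/
theorem lazy_iterates_converge_to_cesaro_projection {d : ℕ}
    (E : Matrix (Fin d) (Fin d) ℂ → Matrix (Fin d) (Fin d) ℂ) (hE : IsCPTP E)
    (lam : ℝ) (hlam : lam ∈ Set.Ioo (0 : ℝ) 1) :
    ∃ Einf : Matrix (Fin d) (Fin d) ℂ → Matrix (Fin d) (Fin d) ℂ,
      (∀ X, Tendsto (fun T : ℕ => (T : ℂ)⁻¹ • ∑ i ∈ Finset.range T, E^[i] X)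
        atTop (nhds (Einf X))) ∧
      (∀ X, Tendsto
        (fun n : ℕ => (fun Y => ((1 - lam : ℝ) : ℂ) • E Y + ((lam : ℝ) : ℂ) • Y)^[n] X)
        atTop (nhds (Einf X))) ∧
      IsCPTP Einf ∧
      (∀ X, Einf (Einf X) = Einf X) ∧
      (∀ X, Einf X = X ↔ E X = X) ∧
      (∀ X, (∃ Y, Einf Y = X) ↔ E X = X) := by
  obtain ⟨m, M, hM, hM1⟩ := id hE
  let L : Module.End ℂ (Matrix (Fin d) (Fin d) ℂ) :=
    { toFun := E
      map_add' := by
        intro X Y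
        simp only [hM, Matrix.mul_add, Matrix.add_mul, Finset.sum_add_distrib]
      map_smul' := by
        intro c X
        simp only [hM, Matrix.mul_smul, Matrix.smul_mul, Finset.smul_sum, RingHom.id_apply] }
  have hLE : ⇑L = E := rfl
  let F : Module.End ℂ (Matrix (Fin d) (Fin d) ℂ) :=
    ((1 - lam : ℝ) : ℂ) • L + ((lam : ℝ) : ℂ) • 1
  have hF : ∀ x, F x = ((1 - lam : ℝ) : ℂ) • L x + ((lam : ℝ) : ℂ) • x := fun x => rfl
  have hmain := matrix_main L F hE hlam.1 hlam.2 hF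
  choose Einf hfix hces hlazy using hmain
  have hadd : ∀ X Y, Einf (X + Y) = Einf X + Einf Y := by
    intro X Y
    refine tendsto_nhds_unique (hlazy (X + Y)) (((hlazy X).add (hlazy Y)).congr fun n => ?_)
    rw [map_add]
  have hsmul : ∀ (c : ℂ) X, Einf (c • X) = c • Einf X := by
    intro c X
    refine tendsto_nhds_unique (hlazy (c • X)) (((hlazy X).const_smul c).congr fun n => ?_)
    rw [map_smul]
  let P : Module.End ℂ (Matrix (Fin d) (Fin d) ℂ) :=
    { toFun := Einf, map_add' := hadd, map_smul' := hsmul }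
  have hid : ∀ X, E X = X → Einf X = X := by
    intro X hX
    have hFX : F X = X := by
      rw [hF, hLE, hX, ← add_smul]; simp
    have hn : ∀ n : ℕ, (F ^ n) X = X := by
      intro n
      rw [Module.End.pow_apply]
      exact Function.iterate_fixed hFX n
    refine tendsto_nhds_unique (hlazy X) ?_
    simp [hn]
  have hpow : ∀ n X, (L ^ n) X = E^[n] X := fun n X => by rw [Module.End.pow_apply, hLE]
  refine ⟨Einf, ?_, ?_, ?_, ?_, ?_, ?_⟩
  · intro X
    simpa only [hpow] using hces X
  · intro X
    have := hlazy X
    simp only [Module.End.pow_apply] at this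
    exact this
  · refine isCPTP_of_choi P ?_ ?_
    · refine posSemidef_of_tendsto
        (fun T : ℕ => (T : ℂ)⁻¹ • ∑ i ∈ Finset.range T, choi (E^[i])) _ ?_ ?_
      · intro T
        refine (posSemidef_sum _ fun i _ => (hE.iterate i).choi_psd).smul ?_
        rw [← Complex.ofReal_natCast, ← Complex.ofReal_inv, Complex.zero_le_real]
        positivity
      · intro p q
        have := ((hces (Matrix.single p.2 q.2 1)).apply_nhds p.1).apply_nhds q.1
        refine this.congr fun T => ?_
        simp only [Matrix.smul_apply, Matrix.sum_apply, choi, hpow]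
    · intro X
      have hc : Continuous (fun Y : Matrix (Fin d) (Fin d) ℂ => Y.trace) :=
        continuous_id.matrix_trace
      refine tendsto_nhds_unique ((hc.tendsto _).comp (hces X))
        ((tendsto_const_nhds (x := X.trace)).congr' ?_)
      filter_upwards [eventually_gt_atTop 0] with T hT
      simp only [Function.comp, Matrix.trace_smul, Matrix.trace_sum, hpow,
        (hE.iterate _).trace_eq, Finset.sum_const, Finset.card_range, nsmul_eq_mul, smul_eq_mul]
      rw [← mul_assoc, inv_mul_cancel₀ (by exact_mod_cast hT.ne'), one_mul]
  · intro X
    exact hid _ (hfix X)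
  · intro X
    refine ⟨fun h => ?_, hid X⟩
    rw [← h]; exact hfix X
  · intro X
    refine ⟨?_, fun h => ⟨X, hid X h⟩⟩
    rintro ⟨Y, rfl⟩
    exact hfix Y
end

section
/- Let V_1,…,V_r be subspaces of ℂ^d whose intersection V̂ = ⋂_{j=1}^r V_j is nonzero. Let P_j be the orthogonal projection matrix onto V_j, P_j^⊥ = I − P_j, and define the linear maps E_j(X) = P_j X P_j + (Tr(P_j^⊥ X)/Tr(P_j)) P_j on d×d matrices. Then each E_j is a CPTP projection whose fixed-point set is {X : P_j X P_j = X} (the matrices supported on V_j), and for every density matrix τ the cyclic iterates (E_r∘⋯∘E_1)^n(τ) converge as n → ∞. Moreover, the limit map τ ↦ lim_n (E_r∘⋯∘E_1)^n(τ) is a CPTP projection whose fixed-point set equals {X : P̂ X P̂ = X}, where P̂ is the orthogonal projection onto V̂; in particular every density matrix converges to a density matrix supported on V̂. -/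
open Matrix Filter
open scoped ComplexOrder

/-- A density matrix: positive semidefinite with trace one. -/
def IsDensity {d : ℕ} (ρ : Matrix (Fin d) (Fin d) ℂ) : Prop :=
  ρ.PosSemidef ∧ ρ.trace = 1

/-- The map `E(X) = P X P + (Tr(P^⊥ X)/Tr(P)) P` associated to a projection matrix `P`. -/
noncomputable def projMap {d : ℕ} (P : Matrix (Fin d) (Fin d) ℂ) :
    Matrix (Fin d) (Fin d) ℂ → Matrix (Fin d) (Fin d) ℂ :=
  fun X => P * X * P + (((1 - P) * X).trace / P.trace) • P

/-- One cycle of the maps `F 0, F 1, …, F (r-1)` (applied in this order), i.e.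
`E_r ∘ ⋯ ∘ E_1` when `E_j = F (j-1)`. -/
def cycleOf {α : Type*} {r : ℕ} (F : Fin r → (α → α)) : α → α :=
  fun x => (List.ofFn F).foldl (fun y f => f y) x

namespace AltProj

variable {d : ℕ}

/-- Orthogonal projection matrices with nonzero trace. -/
def IsPr (P : Matrix (Fin d) (Fin d) ℂ) : Prop := Pᴴ = P ∧ P * P = P ∧ P ≠ 0

lemma IsPr.posSemidef {P : Matrix (Fin d) (Fin d) ℂ} (h : IsPr P) : P.PosSemidef := by
  have := Matrix.posSemidef_conjTranspose_mul_self P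
  rwa [h.1, h.2.1] at this

lemma IsPr.trace_ne {P : Matrix (Fin d) (Fin d) ℂ} (h : IsPr P) : P.trace ≠ 0 := by
  intro h0
  exact h.2.2 (h.posSemidef.trace_eq_zero_iff.1 h0)

lemma IsPr.trace_pos {P : Matrix (Fin d) (Fin d) ℂ} (h : IsPr P) : 0 < P.trace :=
  lt_of_le_of_ne h.posSemidef.trace_nonneg (Ne.symm h.trace_ne)

lemma IsPr.mul_compl {P : Matrix (Fin d) (Fin d) ℂ} (h : IsPr P) : P * (1 - P) = 0 := by
  rw [mul_sub, mul_one, h.2.1, sub_self]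

lemma IsPr.compl_mul {P : Matrix (Fin d) (Fin d) ℂ} (h : IsPr P) : (1 - P) * P = 0 := by
  rw [sub_mul, one_mul, h.2.1, sub_self]

lemma IsPr.compl_idem {P : Matrix (Fin d) (Fin d) ℂ} (h : IsPr P) :
    (1 - P) * (1 - P) = 1 - P := by
  rw [mul_sub, mul_one, h.compl_mul, sub_zero]

lemma IsPr.compl_herm {P : Matrix (Fin d) (Fin d) ℂ} (h : IsPr P) : (1 - P)ᴴ = 1 - P := by
  rw [conjTranspose_sub, conjTranspose_one, h.1]

open scoped MatrixOrder in
lemma exists_gram {X : Matrix (Fin d) (Fin d) ℂ} (hX : X.PosSemidef) :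
    ∃ B : Matrix (Fin d) (Fin d) ℂ, X = Bᴴ * B :=
  CStarAlgebra.nonneg_iff_eq_star_mul_self.mp hX.nonneg

lemma sum_single_sandwich (A : Matrix (Fin d) (Fin d) ℂ) :
    ∑ q : Fin d × Fin d, Matrix.single q.1 q.2 (1 : ℂ) * A * Matrix.single q.2 q.1 (1 : ℂ)
      = A.trace • (1 : Matrix (Fin d) (Fin d) ℂ) := by
  rw [Fintype.sum_prod_type]
  simp only [Matrix.single_mul_mul_single, one_mul, mul_one]
  ext a b
  simp only [Matrix.sum_apply, Matrix.smul_apply, Matrix.single_apply, Matrix.trace,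
    Matrix.diag_apply, Matrix.one_apply]
  by_cases hab : a = b
  · subst hab
    simp
  · have : ∀ x : Fin d, ¬ (x = a ∧ x = b) := fun x h => hab (h.1 ▸ h.2)
    simp [this, hab]

lemma sum_single_sandwich' (A : Matrix (Fin d) (Fin d) ℂ) :
    ∑ q : Fin d × Fin d, Matrix.single q.2 q.1 (1 : ℂ) * A * Matrix.single q.1 q.2 (1 : ℂ)
      = A.trace • (1 : Matrix (Fin d) (Fin d) ℂ) := by
  rw [← sum_single_sandwich A]
  exact Fintype.sum_equiv (Equiv.prodComm _ _) _ _ (fun _ => rfl)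

lemma isCPTP_of_fintype {ι : Type*} [Fintype ι]
    {E : Matrix (Fin d) (Fin d) ℂ → Matrix (Fin d) (Fin d) ℂ}
    (M : ι → Matrix (Fin d) (Fin d) ℂ) (h1 : ∀ X, E X = ∑ k, M k * X * (M k)ᴴ)
    (h2 : ∑ k, (M k)ᴴ * M k = 1) : IsCPTP E := by
  refine ⟨Fintype.card ι, fun k => M ((Fintype.equivFin ι).symm k), fun X => ?_, ?_⟩
  · rw [h1]
    exact (Fintype.sum_equiv (Fintype.equivFin ι).symm _ _ (fun _ => rfl)).symm
  · rw [← h2]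
    exact Fintype.sum_equiv (Fintype.equivFin ι).symm _ _ (fun _ => rfl)

lemma IsPr.trace_compl {P : Matrix (Fin d) (Fin d) ℂ} (h : IsPr P)
    (X : Matrix (Fin d) (Fin d) ℂ) :
    ((1 - P) * X * (1 - P)).trace = ((1 - P) * X).trace := by
  rw [Matrix.trace_mul_comm, ← mul_assoc, h.compl_idem]

lemma IsPr.isCPTP {P : Matrix (Fin d) (Fin d) ℂ} (h : IsPr P) : IsCPTP (projMap P) := by
  obtain ⟨t, ht0, ht⟩ : ∃ t : ℝ, 0 < t ∧ P.trace = (t : ℂ) := by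
    have := h.trace_pos
    rw [Complex.lt_def] at this
    refine ⟨P.trace.re, this.1, ?_⟩
    apply Complex.ext
    · simp
    · simpa using this.2.symm
  obtain ⟨c, hc⟩ : ∃ c : ℂ, c = (((Real.sqrt t)⁻¹ : ℝ) : ℂ) := ⟨_, rfl⟩
  have hcc : c * c = (P.trace)⁻¹ := by
    rw [hc, ht, ← Complex.ofReal_mul, ← mul_inv, Real.mul_self_sqrt ht0.le, Complex.ofReal_inv]
  have hcs : star c = c := by
    rw [hc]; exact Complex.conj_ofReal _
  let M : Option (Fin d × Fin d) → Matrix (Fin d) (Fin d) ℂ := fun o =>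
    match o with
    | none => P
    | some q => c • (P * Matrix.single q.1 q.2 (1 : ℂ) * (1 - P))
  have hM : ∀ q, (M (some q))ᴴ = c • ((1 - P) * Matrix.single q.2 q.1 (1 : ℂ) * P) := by
    intro q
    simp only [M, conjTranspose_smul, conjTranspose_mul, h.1, h.compl_herm, hcs,
      Matrix.conjTranspose_single, star_one, mul_assoc]
  refine isCPTP_of_fintype M (fun X => ?_) ?_
  · rw [Fintype.sum_option]
    have e : ∀ q, M (some q) * X * (M (some q))ᴴ = (P.trace)⁻¹ •
        (P * (Matrix.single q.1 q.2 (1 : ℂ) * ((1 - P) * X * (1 - P)) *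
          Matrix.single q.2 q.1 (1 : ℂ)) * P) := by
      intro q
      rw [hM, ← hcc]
      simp only [M, smul_mul_assoc, mul_smul_comm, smul_smul, mul_assoc]
    simp only [e]
    rw [← Finset.smul_sum, ← Finset.sum_mul, ← Finset.mul_sum, sum_single_sandwich,
      h.trace_compl]
    simp only [M, projMap, h.1, mul_smul_comm, smul_mul_assoc, mul_one, h.2.1, smul_smul]
    rw [div_eq_inv_mul]
  · rw [Fintype.sum_option]
    have e : ∀ q, (M (some q))ᴴ * M (some q) = (P.trace)⁻¹ •
        ((1 - P) * (Matrix.single q.2 q.1 (1 : ℂ) * P *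
          Matrix.single q.1 q.2 (1 : ℂ)) * (1 - P)) := by
      intro q
      rw [hM, ← hcc]
      have h2 : ∀ Y, P * (P * Y) = P * Y := fun Y => by rw [← mul_assoc, h.2.1]
      simp only [M, smul_mul_assoc, mul_smul_comm, smul_smul, mul_assoc, h2]
    simp only [e]
    rw [← Finset.smul_sum, ← Finset.sum_mul, ← Finset.mul_sum, sum_single_sandwich']
    simp only [M, h.1, mul_smul_comm, smul_mul_assoc, mul_one, h.2.1, smul_smul,
      h.compl_idem, inv_mul_cancel₀ h.trace_ne, one_smul]
    abel

lemma IsPr.sandwich {P : Matrix (Fin d) (Fin d) ℂ} (h : IsPr P)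
    (X : Matrix (Fin d) (Fin d) ℂ) : P * projMap P X * P = projMap P X := by
  have h2 : ∀ Y, P * (P * Y) = P * Y := fun Y => by rw [← mul_assoc, h.2.1]
  simp only [projMap, mul_add, add_mul, mul_smul_comm, smul_mul_assoc, h.2.1, mul_assoc, h2]

lemma IsPr.fixed {P : Matrix (Fin d) (Fin d) ℂ} (h : IsPr P)
    {X : Matrix (Fin d) (Fin d) ℂ} (hX : P * X * P = X) : projMap P X = X := by
  have : (1 - P) * X = 0 := by
    rw [← hX, ← mul_assoc, ← mul_assoc, h.compl_mul, zero_mul, zero_mul]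
  simp [projMap, this, hX]

lemma IsPr.fixed_iff {P : Matrix (Fin d) (Fin d) ℂ} (h : IsPr P)
    (X : Matrix (Fin d) (Fin d) ℂ) : projMap P X = X ↔ P * X * P = X := by
  refine ⟨fun hX => ?_, h.fixed⟩
  have := h.sandwich X
  rwa [hX] at this

lemma IsPr.trace_projMap {P : Matrix (Fin d) (Fin d) ℂ} (h : IsPr P)
    (X : Matrix (Fin d) (Fin d) ℂ) : (projMap P X).trace = X.trace := by
  have e : (P * X * P).trace = (P * X).trace := by
    rw [Matrix.trace_mul_comm, ← mul_assoc, h.2.1]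
  rw [projMap, Matrix.trace_add, Matrix.trace_smul, smul_eq_mul, div_mul_cancel₀ _ h.trace_ne, e,
    sub_mul, one_mul, Matrix.trace_sub]
  ring

lemma IsPr.compl_nonneg {P : Matrix (Fin d) (Fin d) ℂ} (h : IsPr P)
    {X : Matrix (Fin d) (Fin d) ℂ} (hX : X.PosSemidef) :
    ((1 - P) * X * (1 - P)).PosSemidef := by
  have := hX.conjTranspose_mul_mul_same (1 - P)
  rwa [h.compl_herm] at this

lemma IsPr.density {P : Matrix (Fin d) (Fin d) ℂ} (h : IsPr P)
    {X : Matrix (Fin d) (Fin d) ℂ} (hX : IsDensity X) : IsDensity (projMap P X) := by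
  refine ⟨?_, by rw [h.trace_projMap, hX.2]⟩
  have h1 := hX.1.conjTranspose_mul_mul_same P
  rw [h.1] at h1
  refine h1.add (h.posSemidef.smul ?_)
  rw [← h.trace_compl, div_eq_mul_inv]
  exact mul_nonneg (h.compl_nonneg hX.1).trace_nonneg (inv_nonneg.2 h.trace_pos.le)

lemma IsPr.of_trace_zero {P : Matrix (Fin d) (Fin d) ℂ} (h : IsPr P)
    {X : Matrix (Fin d) (Fin d) ℂ} (hX : X.PosSemidef) (h0 : ((1 - P) * X).trace = 0) :
    P * X * P = X := by
  rw [← h.trace_compl] at h0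
  have h1 := (h.compl_nonneg hX).trace_eq_zero_iff.1 h0
  obtain ⟨B, rfl⟩ : ∃ B : Matrix (Fin d) (Fin d) ℂ, X = Bᴴ * B :=
    exists_gram hX
  have h2 : (B * (1 - P))ᴴ * (B * (1 - P)) = 0 := by
    rw [conjTranspose_mul, h.compl_herm, ← h1]
    simp only [mul_assoc]
  have h3 : B * (1 - P) = 0 := Matrix.conjTranspose_mul_self_eq_zero.1 h2
  have h4 : B * P = B := by
    rw [mul_sub, mul_one, sub_eq_zero] at h3
    exact h3.symm
  have h5 : P * Bᴴ = Bᴴ := by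
    have := congrArg conjTranspose h4
    rwa [conjTranspose_mul, h.1] at this
  rw [← mul_assoc, h5, mul_assoc, h4]

/-- `Q ≤ P` for projections. -/
lemma absorb' {P Q : Matrix (Fin d) (Fin d) ℂ} (hP : IsPr P) (hQ : IsPr Q) (h : P * Q = Q) :
    Q * P = Q := by
  have := congrArg conjTranspose h
  rwa [conjTranspose_mul, hP.1, hQ.1] at this

lemma trace_step {P Q : Matrix (Fin d) (Fin d) ℂ} (hP : IsPr P) (hQ : IsPr Q) (h : P * Q = Q)
    (X : Matrix (Fin d) (Fin d) ℂ) :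
    (Q * projMap P X).trace = (Q * X).trace + ((1 - P) * X).trace / P.trace * Q.trace := by
  have h' := absorb' hP hQ h
  rw [projMap, mul_add, Matrix.trace_add, mul_smul_comm, Matrix.trace_smul, h', smul_eq_mul,
    ← mul_assoc, ← mul_assoc, h', Matrix.trace_mul_comm, ← mul_assoc, h]

lemma comp_step {P Q : Matrix (Fin d) (Fin d) ℂ} (hP : IsPr P) (hQ : IsPr Q) (h : P * Q = Q)
    (X : Matrix (Fin d) (Fin d) ℂ) : projMap Q (projMap P X) = projMap Q X := by
  have h' := absorb' hP hQ h
  have e1 : Q * projMap P X * Q = Q * X * Q + (((1 - P) * X).trace / P.trace) • Q := by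
    rw [projMap, mul_add, add_mul, mul_smul_comm, smul_mul_assoc, h', hQ.2.1, ← mul_assoc,
      ← mul_assoc, h', mul_assoc _ P Q, h]
  have e2 : ((1 - Q) * projMap P X).trace
      = ((1 - Q) * X).trace - ((1 - P) * X).trace / P.trace * Q.trace := by
    rw [sub_mul, one_mul, Matrix.trace_sub, hP.trace_projMap, trace_step hP hQ h, sub_mul 1 Q X,
      one_mul, Matrix.trace_sub]
    ring
  rw [projMap, e1, e2, sub_div, mul_div_assoc, div_self hQ.trace_ne, mul_one, sub_smul, projMap]
  abel

lemma step_mono {P Q : Matrix (Fin d) (Fin d) ℂ} (hP : IsPr P) (hQ : IsPr Q) (h : P * Q = Q)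
    {X : Matrix (Fin d) (Fin d) ℂ} (hX : IsDensity X) :
    (Q * X).trace ≤ (Q * projMap P X).trace := by
  rw [trace_step hP hQ h, ← hP.trace_compl, div_eq_mul_inv]
  exact le_add_of_nonneg_right (mul_nonneg (mul_nonneg (hP.compl_nonneg hX.1).trace_nonneg
    (inv_nonneg.2 hP.trace_pos.le)) hQ.trace_pos.le)

lemma step_eq {P Q : Matrix (Fin d) (Fin d) ℂ} (hP : IsPr P) (hQ : IsPr Q) (h : P * Q = Q)
    {X : Matrix (Fin d) (Fin d) ℂ} (hX : IsDensity X)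
    (he : (Q * projMap P X).trace = (Q * X).trace) : P * X * P = X := by
  apply hP.of_trace_zero hX.1
  rw [trace_step hP hQ h, add_eq_left, mul_eq_zero, div_eq_zero_iff] at he
  rcases he with (he | he) | he
  · exact he
  · exact absurd he hP.trace_ne
  · exact absurd he hQ.trace_ne

/-- Fold of a list of projections. -/
noncomputable def run (l : List (Matrix (Fin d) (Fin d) ℂ)) (X : Matrix (Fin d) (Fin d) ℂ) :
    Matrix (Fin d) (Fin d) ℂ := l.foldl (fun y P => projMap P y) X

lemma run_props {Q : Matrix (Fin d) (Fin d) ℂ} (hQ : IsPr Q)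
    (l : List (Matrix (Fin d) (Fin d) ℂ)) (hl : ∀ P ∈ l, IsPr P ∧ P * Q = Q) :
    ∀ X, IsDensity X → IsDensity (run l X) ∧ projMap Q (run l X) = projMap Q X ∧
      (Q * X).trace ≤ (Q * run l X).trace ∧
      ((Q * run l X).trace = (Q * X).trace → ∀ P ∈ l, P * X * P = X) := by
  induction l with
  | nil => intro X hX; exact ⟨hX, rfl, le_rfl, fun _ P hP => by simp at hP⟩
  | cons P l ih =>
    intro X hX
    obtain ⟨hP, hPQ⟩ := hl P (by simp)
    obtain ⟨i1, i2, i3, i4⟩ := ih (fun R hR => hl R (by simp [hR])) _ (hP.density hX)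
    have hm := step_mono hP hQ hPQ hX
    have hr : run (P :: l) X = run l (projMap P X) := rfl
    rw [hr]
    refine ⟨i1, by rw [i2, comp_step hP hQ hPQ], hm.trans i3, fun he => ?_⟩
    have e1 : (Q * projMap P X).trace = (Q * X).trace := le_antisymm (i3.trans he.le) hm
    have e2 := step_eq hP hQ hPQ hX e1
    have e3 := hP.fixed e2
    rw [e3] at i4 he
    intro R hR
    rcases List.mem_cons.1 hR with rfl | hR
    · exact e2
    · exact i4 he R hR

lemma projMap_continuous (P : Matrix (Fin d) (Fin d) ℂ) : Continuous (projMap P) := by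
  unfold projMap
  refine Continuous.add (by fun_prop) (Continuous.fun_smul ?_ continuous_const)
  refine Continuous.div_const ?_ _
  exact Continuous.matrix_trace (by fun_prop)

lemma run_continuous (l : List (Matrix (Fin d) (Fin d) ℂ)) : Continuous (run l) := by
  induction l with
  | nil => exact continuous_id
  | cons P l ih => exact ih.comp (projMap_continuous P)

lemma isCompact_density : IsCompact {X : Matrix (Fin d) (Fin d) ℂ | IsDensity X} := by
  have hb : IsCompact (Set.univ.pi fun _ : Fin d => Set.univ.pi fun _ : Fin d =>
      Metric.closedBall (0 : ℂ) 1) :=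
    isCompact_univ_pi fun _ => isCompact_univ_pi fun _ => isCompact_closedBall _ _
  have hcont : Continuous (fun B : Matrix (Fin d) (Fin d) ℂ => Bᴴ * B) := by fun_prop
  have hclosed : IsClosed {B : Matrix (Fin d) (Fin d) ℂ | (Bᴴ * B).trace = 1} :=
    isClosed_eq hcont.matrix_trace continuous_const
  have hK : IsCompact {B : Matrix (Fin d) (Fin d) ℂ | (Bᴴ * B).trace = 1} := by
    refine IsCompact.of_isClosed_subset hb hclosed ?_
    intro B hB i _ j _
    have hB' : (Bᴴ * B).trace = 1 := hB
    have e : (Bᴴ * B).trace = ((∑ j, ∑ i, ‖B i j‖ ^ 2 : ℝ) : ℂ) := by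
      simp only [Matrix.trace, Matrix.diag_apply, Matrix.mul_apply, conjTranspose_apply]
      push_cast
      refine Finset.sum_congr rfl fun j _ => Finset.sum_congr rfl fun i _ => ?_
      exact Complex.conj_mul' _
    rw [e] at hB'
    have hs : (∑ j, ∑ i, ‖B i j‖ ^ 2 : ℝ) = 1 := by exact_mod_cast hB'
    have h1 : ‖B i j‖ ^ 2 ≤ ∑ i, ‖B i j‖ ^ 2 :=
      Finset.single_le_sum (f := fun i => ‖B i j‖ ^ 2) (fun _ _ => by positivity)
        (Finset.mem_univ i)
    have h2 : ∑ i, ‖B i j‖ ^ 2 ≤ ∑ j, ∑ i, ‖B i j‖ ^ 2 :=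
      Finset.single_le_sum (f := fun j => ∑ i, ‖B i j‖ ^ 2) (fun _ _ => by positivity)
        (Finset.mem_univ j)
    have h3 : ‖B i j‖ ^ 2 ≤ 1 := by linarith
    rw [mem_closedBall_zero_iff]
    nlinarith [norm_nonneg (B i j)]
  have := hK.image hcont
  convert this using 1
  ext X
  constructor
  · rintro ⟨h1, h2⟩
    obtain ⟨B, rfl⟩ : ∃ B : Matrix (Fin d) (Fin d) ℂ, X = Bᴴ * B :=
      exists_gram h1
    exact ⟨B, h2, rfl⟩
  · rintro ⟨B, hB, rfl⟩
    exact ⟨Matrix.posSemidef_conjTranspose_mul_self B, hB⟩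

lemma tendsto_run {Q : Matrix (Fin d) (Fin d) ℂ} (hQ : IsPr Q)
    (l : List (Matrix (Fin d) (Fin d) ℂ)) (hl : ∀ P ∈ l, IsPr P ∧ P * Q = Q)
    (hsupp : ∀ X, IsDensity X → (∀ P ∈ l, P * X * P = X) → Q * X * Q = X)
    (τ : Matrix (Fin d) (Fin d) ℂ) (hτ : IsDensity τ) :
    Tendsto (fun n : ℕ => (run l)^[n] τ) atTop (nhds (projMap Q τ)) := by
  have hd : ∀ n : ℕ, IsDensity ((run l)^[n] τ) ∧ projMap Q ((run l)^[n] τ) = projMap Q τ := by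
    intro n
    induction n with
    | zero => exact ⟨hτ, rfl⟩
    | succ n ih =>
      rw [Function.iterate_succ_apply']
      obtain ⟨a, b, -, -⟩ := run_props hQ l hl _ ih.1
      exact ⟨a, b.trans ih.2⟩
  let h : Matrix (Fin d) (Fin d) ℂ → ℝ := fun X => (Q * X).trace.re
  have hc : Continuous h :=
    Complex.continuous_re.comp (Continuous.matrix_trace (by fun_prop))
  have hmono : Monotone fun n : ℕ => h ((run l)^[n] τ) := by
    refine monotone_nat_of_le_succ fun n => ?_
    rw [Function.iterate_succ_apply']
    exact (Complex.le_def.1 (run_props hQ l hl _ (hd n).1).2.2.1).1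
  have hbdd : BddAbove (Set.range fun n : ℕ => h ((run l)^[n] τ)) := by
    refine (isCompact_density.image hc).bddAbove.mono ?_
    rintro _ ⟨n, rfl⟩
    exact ⟨_, (hd n).1, rfl⟩
  obtain ⟨s, hs⟩ : ∃ s, Tendsto (fun n : ℕ => h ((run l)^[n] τ)) atTop (nhds s) :=
    ⟨_, tendsto_atTop_ciSup hmono hbdd⟩
  have hs' : Tendsto (fun n : ℕ => h (run l ((run l)^[n] τ))) atTop (nhds s) := by
    have := hs.comp (tendsto_add_atTop_nat 1)
    refine this.congr fun n => ?_
    simp only [Function.comp, Function.iterate_succ_apply']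
  refine isCompact_density.tendsto_nhds_of_unique_mapClusterPt
    (Eventually.of_forall fun n => (hd n).1) ?_
  intro σ hσ hcl
  have key : ∀ {Y : Type} [TopologicalSpace Y] [T2Space Y]
      (φ : Matrix (Fin d) (Fin d) ℂ → Y) (y : Y), Continuous φ →
      Tendsto (fun n : ℕ => φ ((run l)^[n] τ)) atTop (nhds y) → φ σ = y := by
    intro Y _ _ φ y hφ ht
    have h1 : MapClusterPt (φ σ) atTop (fun n : ℕ => φ ((run l)^[n] τ)) :=
      hcl.continuousAt_comp hφ.continuousAt
    by_contra hne
    have hdis := disjoint_nhds_nhds.2 hne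
    have : (nhds (φ σ) ⊓ map (fun n : ℕ => φ ((run l)^[n] τ)) atTop).NeBot := h1
    exact this.ne (disjoint_iff.1 (hdis.mono_right ht))
  have k1 : h σ = s := key h s hc hs
  have k2 : h (run l σ) = s := key _ s (hc.comp (run_continuous l)) hs'
  have k3 : projMap Q σ = projMap Q τ := by
    refine key _ _ (projMap_continuous Q) ?_
    simp only [fun n => (hd n).2]
    exact tendsto_const_nhds
  obtain ⟨-, -, p3, p4⟩ := run_props hQ l hl σ hσ
  have he : (Q * run l σ).trace = (Q * σ).trace :=
    Complex.ext (k2.trans k1.symm) (Complex.le_def.1 p3).2.symm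
  rw [← k3, hQ.fixed (hsupp σ hσ (p4 he))]

end AltProj

/-- Alternating CPTP projections onto matrix algebras of subspaces: each `projMap (P j)` is a
CPTP projection with fixed-point set the matrices supported on `V j`, the cyclic iterates
converge on every density matrix, and the limit map is a CPTP projection whose fixed-point
set consists of the matrices supported on `⋂ j, V j`; in particular every density matrix
converges to a density matrix supported on the intersection. -/
theorem alternating_subspace_projections {d r : ℕ}
    (V : Fin r → Submodule ℂ (Fin d → ℂ)) (hV : (⨅ j, V j) ≠ ⊥)
    (P : Fin r → Matrix (Fin d) (Fin d) ℂ)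
    (hP : ∀ j, (P j)ᴴ = P j ∧ P j * P j = P j ∧
      LinearMap.range (P j).mulVecLin = V j)
    (Phat : Matrix (Fin d) (Fin d) ℂ)
    (hPhat : Phatᴴ = Phat ∧ Phat * Phat = Phat ∧
      LinearMap.range Phat.mulVecLin = ⨅ j, V j) :
    (∀ j, IsCPTP (projMap (P j)) ∧
      (∀ X, projMap (P j) (projMap (P j) X) = projMap (P j) X) ∧
      (∀ X, projMap (P j) X = X ↔ P j * X * P j = X)) ∧
    ∃ L : Matrix (Fin d) (Fin d) ℂ → Matrix (Fin d) (Fin d) ℂ,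
      IsCPTP L ∧ (∀ X, L (L X) = L X) ∧
      (∀ X, L X = X ↔ Phat * X * Phat = X) ∧
      (∀ τ, IsDensity τ →
        Tendsto (fun n : ℕ => (cycleOf (fun j => projMap (P j)))^[n] τ)
          atTop (nhds (L τ)) ∧
        IsDensity (L τ) ∧ Phat * L τ * Phat = L τ) := by
  have absorb : ∀ (R : Matrix (Fin d) (Fin d) ℂ) (W : Submodule ℂ (Fin d → ℂ)), R * R = R →
      LinearMap.range R.mulVecLin = W → ∀ A : Matrix (Fin d) (Fin d) ℂ,
      (∀ v, A *ᵥ v ∈ W) → R * A = A := by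
    intro R W hR hW A hA
    apply Matrix.ext_of_mulVec_single
    intro i
    have := hA (Pi.single i 1)
    rw [← hW] at this
    obtain ⟨w, hw⟩ := this
    rw [Matrix.mulVecLin_apply] at hw
    rw [← Matrix.mulVec_mulVec, ← hw, Matrix.mulVec_mulVec, hR]
  have memr : ∀ (R : Matrix (Fin d) (Fin d) ℂ) v, R *ᵥ v ∈ LinearMap.range R.mulVecLin :=
    fun R v => ⟨v, rfl⟩
  have hQ : AltProj.IsPr Phat := by
    refine ⟨hPhat.1, hPhat.2.1, fun h0 => hV ?_⟩
    rw [← hPhat.2.2, h0, Matrix.mulVecLin_zero, LinearMap.range_zero]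
  have hPQ : ∀ j, P j * Phat = Phat := by
    intro j
    refine absorb _ _ (hP j).2.1 (hP j).2.2 _ fun v => ?_
    have := memr Phat v
    rw [hPhat.2.2] at this
    exact (iInf_le V j) this
  have hPr : ∀ j, AltProj.IsPr (P j) := by
    intro j
    refine ⟨(hP j).1, (hP j).2.1, fun h0 => hQ.2.2 ?_⟩
    rw [← hPQ j, h0, zero_mul]
  refine ⟨fun j => ⟨(hPr j).isCPTP, fun X => (hPr j).fixed ((hPr j).sandwich X),
    (hPr j).fixed_iff⟩, projMap Phat, hQ.isCPTP, fun X => hQ.fixed (hQ.sandwich X),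
    hQ.fixed_iff, fun τ hτ => ⟨?_, hQ.density hτ, hQ.sandwich τ⟩⟩
  have hcyc : cycleOf (fun j => projMap (P j)) = AltProj.run (List.ofFn P) := by
    funext X
    have : List.ofFn (fun j => projMap (P j)) = (List.ofFn P).map projMap := by
      rw [List.map_ofFn]; rfl
    rw [cycleOf, this, List.foldl_map, AltProj.run]
  rw [hcyc]
  refine AltProj.tendsto_run hQ _ ?_ ?_ τ hτ
  · intro R hR
    obtain ⟨j, rfl⟩ := (List.mem_ofFn' P R).1 hR
    exact ⟨hPr j, hPQ j⟩
  · intro X hX hall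
    have hx : ∀ j, P j * X * P j = X := fun j => hall _ ((List.mem_ofFn' P _).2 ⟨j, rfl⟩)
    have h1 : Phat * X = X := by
      refine absorb _ _ hPhat.2.1 hPhat.2.2 _ fun v => ?_
      rw [Submodule.mem_iInf]
      intro j
      rw [← (hP j).2.2, ← hx j, mul_assoc, ← Matrix.mulVec_mulVec]
      exact memr _ _
    have h2 : X * Phat = X := by
      have := congrArg conjTranspose h1
      rwa [conjTranspose_mul, hX.1.1, hPhat.1] at this
    rw [h1, h2]
end

section
/- Let E_1,…,E_r be CPTP projections on the d×d complex matrices that admit a common positive-definite fixed density matrix ρ (E_i(ρ) = ρ for all i, ρ positive definite of trace 1). Then the cyclic iterates (E_r∘⋯∘E_1)^n converge as n → ∞ (entrywise as linear maps) to a map Ê which is a CPTP projection with fix(Ê) = range(Ê) = ⋂_{i=1}^r fix(E_i). In particular, for every density matrix τ, lim_{n→∞} (E_r∘⋯∘E_1)^n(τ) = Ê(τ), which lies in ⋂_i fix(E_i). -/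
open Matrix Filter
open scoped ComplexOrder

section helpers

variable {d : ℕ}

lemma cptp_id : IsCPTP (fun X : Matrix (Fin d) (Fin d) ℂ => X) :=
  ⟨1, fun _ => 1, by simp, by simp⟩

lemma cptp_of_fintype {ι : Type*} [Fintype ι] (M : ι → Matrix (Fin d) (Fin d) ℂ)
    (F : Matrix (Fin d) (Fin d) ℂ → Matrix (Fin d) (Fin d) ℂ)
    (h1 : ∀ X, F X = ∑ k, M k * X * (M k)ᴴ) (h2 : ∑ k, (M k)ᴴ * M k = 1) : IsCPTP F := by
  let e := (Fintype.equivFin ι).symm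
  refine ⟨Fintype.card ι, fun k => M (e k), fun X => ?_, ?_⟩
  · rw [h1]; exact (e.sum_comp (fun k => M k * X * (M k)ᴴ)).symm
  · rw [← h2]; exact (e.sum_comp (fun k => (M k)ᴴ * M k))

lemma cptp_comp {F G : Matrix (Fin d) (Fin d) ℂ → Matrix (Fin d) (Fin d) ℂ}
    (hF : IsCPTP F) (hG : IsCPTP G) : IsCPTP (fun X => F (G X)) := by
  obtain ⟨m, M, hM, hM1⟩ := hF
  obtain ⟨n, N, hN, hN1⟩ := hG
  refine cptp_of_fintype (fun p : Fin n × Fin m => M p.2 * N p.1) _ (fun X => ?_) ?_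
  · simp only [hM, hN, Finset.mul_sum, Finset.sum_mul, Fintype.sum_prod_type,
      conjTranspose_mul, Matrix.mul_assoc]
    rw [Finset.sum_comm]
  · simp only [Fintype.sum_prod_type, conjTranspose_mul]
    rw [← hN1]
    refine Finset.sum_congr rfl fun k _ => ?_
    calc ∑ j, (N k)ᴴ * (M j)ᴴ * (M j * N k) = (N k)ᴴ * (∑ j, (M j)ᴴ * M j) * N k := by
          simp only [Finset.mul_sum, Finset.sum_mul, Matrix.mul_assoc]
      _ = _ := by rw [hM1, Matrix.mul_one]

lemma cptp_iterate {F : Matrix (Fin d) (Fin d) ℂ → Matrix (Fin d) (Fin d) ℂ}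
    (hF : IsCPTP F) (n : ℕ) : IsCPTP (F^[n]) := by
  induction n with
  | zero => exact cptp_id
  | succ n ih =>
    have := cptp_comp ih hF
    exact this

lemma cptp_add {F : Matrix (Fin d) (Fin d) ℂ → Matrix (Fin d) (Fin d) ℂ}
    (hF : IsCPTP F) (X Y) : F (X + Y) = F X + F Y := by
  obtain ⟨m, M, hM, -⟩ := hF
  simp [hM, Matrix.mul_add, Matrix.add_mul, Finset.sum_add_distrib]

lemma cptp_smul {F : Matrix (Fin d) (Fin d) ℂ → Matrix (Fin d) (Fin d) ℂ}
    (hF : IsCPTP F) (c : ℂ) (X) : F (c • X) = c • F X := by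
  obtain ⟨m, M, hM, -⟩ := hF
  simp [hM, Finset.smul_sum]

lemma cptp_trace {F : Matrix (Fin d) (Fin d) ℂ → Matrix (Fin d) (Fin d) ℂ}
    (hF : IsCPTP F) (X) : (F X).trace = X.trace := by
  obtain ⟨m, M, hM, h1⟩ := hF
  calc (F X).trace = ∑ k, ((M k)ᴴ * M k * X).trace := by
        rw [hM, Matrix.trace_sum]
        refine Finset.sum_congr rfl fun k _ => ?_
        rw [Matrix.trace_mul_comm, Matrix.mul_assoc]
    _ = X.trace := by rw [← Matrix.trace_sum, ← Finset.sum_mul, h1, Matrix.one_mul]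

/-- the Choi matrix -/
def choiMat (F : Matrix (Fin d) (Fin d) ℂ → Matrix (Fin d) (Fin d) ℂ) :
    Matrix (Fin d × Fin d) (Fin d × Fin d) ℂ :=
  Matrix.of fun a b => F (Matrix.single a.2 b.2 1) a.1 b.1

lemma kraus_single (M : Matrix (Fin d) (Fin d) ℂ) (k l i j : Fin d) :
    (M * Matrix.single k l (1:ℂ) * Mᴴ) i j = M i k * star (M j l) := by
  rw [Matrix.mul_assoc, Matrix.mul_apply, Finset.sum_eq_single k]
  · congr 1
    rw [Matrix.mul_apply, Finset.sum_eq_single l]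
    · simp
    · intro b _ hb; simp [hb.symm]
    · simp
  · intro b _ hb
    rw [Matrix.mul_apply]
    simp [hb.symm]
  · simp

lemma cptp_choi {F : Matrix (Fin d) (Fin d) ℂ → Matrix (Fin d) (Fin d) ℂ}
    (hF : IsCPTP F) : (choiMat F).PosSemidef := by
  obtain ⟨m, M, hM, -⟩ := hF
  have : choiMat F = (Matrix.of fun (k : Fin m) (a : Fin d × Fin d) => star (M k a.1 a.2))ᴴ *
      (Matrix.of fun (k : Fin m) (a : Fin d × Fin d) => star (M k a.1 a.2)) := by
    ext a b
    simp only [choiMat, Matrix.of_apply, hM, Matrix.sum_apply, kraus_single]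
    simp only [Matrix.mul_apply, Matrix.of_apply, Matrix.conjTranspose_apply, star_star]
  rw [this]
  exact Matrix.posSemidef_conjTranspose_mul_self _

open scoped MatrixOrder in
lemma cptp_of_choi {F : Matrix (Fin d) (Fin d) ℂ → Matrix (Fin d) (Fin d) ℂ}
    (hadd : ∀ X Y, F (X + Y) = F X + F Y) (hsmul : ∀ (c : ℂ) X, F (c • X) = c • F X)
    (htr : ∀ X, (F X).trace = X.trace) (hC : (choiMat F).PosSemidef) : IsCPTP F := by
  obtain ⟨B, hB⟩ : ∃ B : Matrix (Fin d × Fin d) (Fin d × Fin d) ℂ, choiMat F = Bᴴ * B := by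
    obtain ⟨B, hB⟩ := CStarAlgebra.nonneg_iff_eq_star_mul_self.mp hC.nonneg
    exact ⟨B, hB⟩
  let M : Fin d × Fin d → Matrix (Fin d) (Fin d) ℂ := fun m => Matrix.of fun i k => star (B m (i, k))
  let G : Matrix (Fin d) (Fin d) ℂ →ₗ[ℂ] Matrix (Fin d) (Fin d) ℂ :=
    { toFun := fun X => ∑ k, M k * X * (M k)ᴴ
      map_add' := by simp [Matrix.mul_add, Matrix.add_mul, Finset.sum_add_distrib]
      map_smul' := by simp [Finset.smul_sum] }
  let F' : Matrix (Fin d) (Fin d) ℂ →ₗ[ℂ] Matrix (Fin d) (Fin d) ℂ :=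
    { toFun := F, map_add' := hadd, map_smul' := hsmul }
  have hFG : F' = G := by
    refine (Matrix.stdBasis ℂ (Fin d) (Fin d)).ext fun p => ?_
    rw [Matrix.stdBasis_eq_single]
    ext i j
    have := congrFun (congrFun hB (i, p.1)) (j, p.2)
    simp only [choiMat, Matrix.of_apply, Matrix.mul_apply (M := Bᴴ),
      Matrix.conjTranspose_apply] at this
    change F (Matrix.single p.1 p.2 1) i j = (∑ k, M k * (Matrix.single p.1 p.2 1) * (M k)ᴴ : Matrix (Fin d) (Fin d) ℂ) i j
    rw [this]
    simp [Matrix.sum_apply, kraus_single, M]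
  have h1 : ∀ X, F X = ∑ k, M k * X * (M k)ᴴ := fun X => LinearMap.congr_fun hFG X
  refine cptp_of_fintype M F h1 ?_
  refine Matrix.ext_iff_trace_mul_right.mpr fun X => ?_
  rw [Matrix.one_mul, ← htr X, h1, Finset.sum_mul, Matrix.trace_sum, Matrix.trace_sum]
  refine Finset.sum_congr rfl fun k _ => ?_
  rw [Matrix.trace_mul_comm (M k * X), Matrix.mul_assoc]

lemma contraction {F : Matrix (Fin d) (Fin d) ℂ → Matrix (Fin d) (Fin d) ℂ}
    (hF : IsCPTP F) {ρ : Matrix (Fin d) (Fin d) ℂ} (hρ : ρ.PosDef) (hfix : F ρ = ρ) (X) :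
    (F X * ρ⁻¹ * (F X)ᴴ).trace.re ≤ (X * ρ⁻¹ * Xᴴ).trace.re := by
  have hF' := hF
  obtain ⟨m, M, hM, h1⟩ := hF
  set R := ρ⁻¹ with hR
  have hRp : R.PosDef := hρ.inv
  have hu : IsUnit ρ.det := (Matrix.isUnit_iff_isUnit_det _).mp hρ.isUnit
  have hρR : ρ * R = 1 := Matrix.mul_nonsing_inv _ hu
  have hRρ : R * ρ = 1 := Matrix.nonsing_inv_mul _ hu
  have hRH : Rᴴ = R := hRp.isHermitian
  have hρH : ρᴴ = ρ := hρ.isHermitian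
  set Y := F X * R with hY
  have key : F (X * R * Xᴴ) - F X * R * (F X)ᴴ
      = ∑ k, (M k * X - Y * M k * ρ) * R * (M k * X - Y * M k * ρ)ᴴ := by
    have e : ∀ k, (M k * X - Y * M k * ρ) * R * (M k * X - Y * M k * ρ)ᴴ
        = M k * (X * R * Xᴴ) * (M k)ᴴ - (M k * X * (M k)ᴴ) * Yᴴ - Y * (M k * X * (M k)ᴴ)ᴴ
          + Y * (M k * ρ * (M k)ᴴ) * Yᴴ := by
      intro k
      have a : (M k * X - Y * M k * ρ) * R = M k * X * R - Y * M k := by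
        rw [Matrix.sub_mul, Matrix.mul_assoc _ ρ, hρR, Matrix.mul_one]
      rw [a]
      simp only [conjTranspose_sub, conjTranspose_mul, hρH, conjTranspose_conjTranspose]
      simp only [Matrix.sub_mul, Matrix.mul_sub, Matrix.mul_assoc]
      rw [← Matrix.mul_assoc R ρ, hRρ, Matrix.one_mul]
      abel
    simp only [e, Finset.sum_add_distrib, Finset.sum_sub_distrib]
    rw [← Finset.sum_mul, ← Finset.mul_sum, ← Finset.sum_mul, ← Finset.mul_sum,
      ← conjTranspose_sum, ← hM, ← hM, ← hM, hfix, hY, conjTranspose_mul, hRH]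
    have : F X * R * ρ = F X := by rw [Matrix.mul_assoc, hRρ, Matrix.mul_one]
    rw [this, Matrix.mul_assoc (F X)]
    abel
  have hpos : 0 ≤ (F (X * R * Xᴴ) - F X * R * (F X)ᴴ).trace := by
    rw [key, Matrix.trace_sum]
    exact Finset.sum_nonneg fun k _ =>
      (hRp.posSemidef.mul_mul_conjTranspose_same _).trace_nonneg
  rw [Matrix.trace_sub, cptp_trace hF'] at hpos
  have := (Complex.le_def.mp hpos).1
  simp at this
  exact this

open scoped MatrixOrder in
/-- A linear isomorphism to a Hilbert space turning channels fixing `ρ` into contractions. -/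
lemma exists_iso {ρ : Matrix (Fin d) (Fin d) ℂ} (hρ : ρ.PosDef) :
    ∃ L : Matrix (Fin d) (Fin d) ℂ ≃ₗ[ℂ] EuclideanSpace ℂ (Fin d × Fin d),
      ∀ X, ‖L X‖ ^ 2 = (X * ρ⁻¹ * Xᴴ).trace.re := by
  obtain ⟨B, hB⟩ : ∃ B : Matrix (Fin d) (Fin d) ℂ, ρ⁻¹ = Bᴴ * B := by
    obtain ⟨B, hB⟩ := CStarAlgebra.nonneg_iff_eq_star_mul_self.mp hρ.inv.posSemidef.nonneg
    exact ⟨B, hB⟩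
  let L0 : Matrix (Fin d) (Fin d) ℂ →ₗ[ℂ] EuclideanSpace ℂ (Fin d × Fin d) :=
    { toFun := fun X => WithLp.toLp 2 fun p => (X * Bᴴ) p.1 p.2
      map_add' := by intro X Y; ext p; simp [Matrix.add_mul]
      map_smul' := by intro c X; ext p; simp }
  have hn : ∀ X, ‖L0 X‖ ^ 2 = (X * ρ⁻¹ * Xᴴ).trace.re := by
    intro X
    have : X * ρ⁻¹ * Xᴴ = (X * Bᴴ) * (X * Bᴴ)ᴴ := by
      rw [hB]; simp [Matrix.mul_assoc]
    rw [this, EuclideanSpace.norm_sq_eq, Matrix.trace, Fintype.sum_prod_type, Complex.re_sum]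
    refine Finset.sum_congr rfl fun i _ => ?_
    rw [Matrix.diag_apply, Matrix.mul_apply, Complex.re_sum]
    refine Finset.sum_congr rfl fun j _ => ?_
    rw [Matrix.conjTranspose_apply]
    change ‖(X * Bᴴ) i j‖ ^ 2 = _
    rw [Complex.star_def, Complex.mul_conj, Complex.normSq_eq_norm_sq, Complex.ofReal_re]
  have hinj : Function.Injective L0 := by
    rw [injective_iff_map_eq_zero]
    intro X hX
    have h0 : X * Bᴴ = 0 := by
      ext i j
      have := congrArg (fun v : EuclideanSpace ℂ (Fin d × Fin d) => v (i, j)) hX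
      exact this
    have h1 : X * ρ⁻¹ = 0 := by rw [hB, ← Matrix.mul_assoc, h0, Matrix.zero_mul]
    have hu : IsUnit ρ.det := (Matrix.isUnit_iff_isUnit_det _).mp hρ.isUnit
    calc X = X * ρ⁻¹ * ρ := by rw [Matrix.mul_assoc, Matrix.nonsing_inv_mul _ hu, Matrix.mul_one]
      _ = 0 := by rw [h1, Matrix.zero_mul]
  refine ⟨LinearEquiv.ofInjectiveOfFinrankEq L0 hinj ?_, fun X => ?_⟩
  · simp [Module.finrank_matrix]
  · exact hn X

end helpers

/-- An idempotent linear contraction attaining the norm fixes the vector. -/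
lemma fixed_of_norm_eq {V H : Type*} [AddCommGroup V] [Module ℂ V] [NormedAddCommGroup H]
    [InnerProductSpace ℂ H] (L : V ≃ₗ[ℂ] H) (F : V → V)
    (hadd : ∀ X Y, F (X + Y) = F X + F Y) (hidem : ∀ X, F (F X) = F X)
    (hsmul : ∀ (c : ℂ) X, F (c • X) = c • F X)
    (hc : ∀ X, ‖L (F X)‖ ≤ ‖L X‖) (X : V) (h : ‖L (F X)‖ = ‖L X‖) : F X = X := by
  have h2 : F (X + F X) = (2:ℂ) • F X := by rw [hadd, hidem, two_smul]
  have h3 := hc (X + F X)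
  rw [h2, map_smul, norm_smul, map_add] at h3
  have hp := parallelogram_law_with_norm ℂ (L X) (L (F X))
  simp only [Complex.norm_ofNat] at h3
  have h4 : ‖L X - L (F X)‖ = 0 := by
    have h5 : (2 * ‖L (F X)‖) * (2 * ‖L (F X)‖) ≤ ‖L X + L (F X)‖ * ‖L X + L (F X)‖ :=
      mul_self_le_mul_self (by positivity) h3
    rw [← h] at hp
    nlinarith [norm_nonneg (L X - L (F X))]
  rw [norm_sub_eq_zero_iff] at h4
  exact (L.injective h4).symm

/-- Convergence of iterates. -/
lemma tendsto_iterates {H : Type*} [NormedAddCommGroup H] [ProperSpace H]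
    (T : H → H) (hcont : Continuous T)
    (hsub : ∀ x y, T (x - y) = T x - T y)
    (hc : ∀ x, ‖T x‖ ≤ ‖x‖) (hs : ∀ x, ‖T x‖ = ‖x‖ → T x = x) (x : H) :
    ∃ y, T y = y ∧ Tendsto (fun n : ℕ => T^[n] x) atTop (nhds y) := by
  have hanti : ∀ z, Antitone (fun n : ℕ => ‖T^[n] z‖) := fun z =>
    antitone_nat_of_succ_le fun n => by rw [Function.iterate_succ_apply']; exact hc _
  have hmem : ∀ n, T^[n] x ∈ Metric.closedBall (0:H) ‖x‖ := fun n => by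
    simpa using hanti x (Nat.zero_le n)
  obtain ⟨y, -, φ, hφ, hy⟩ := (isCompact_closedBall (0:H) ‖x‖).tendsto_subseq hmem
  obtain ⟨c, hcl⟩ : ∃ c, Tendsto (fun n : ℕ => ‖T^[n] x‖) atTop (nhds c) :=
    ⟨_, tendsto_atTop_ciInf (hanti x) ⟨0, by rintro _ ⟨n, rfl⟩; exact norm_nonneg _⟩⟩
  have e1 : ‖y‖ = c := tendsto_nhds_unique hy.norm (hcl.comp hφ.tendsto_atTop)
  have e2 : ‖T y‖ = c := by
    refine tendsto_nhds_unique ((hcont.tendsto y).comp hy).norm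
      ((hcl.comp ((tendsto_add_atTop_nat 1).comp hφ.tendsto_atTop)).congr fun n => ?_)
    simp only [Function.comp]
    rw [Function.iterate_succ_apply']
  have hTy : T y = y := hs y (e2.trans e1.symm)
  refine ⟨y, hTy, ?_⟩
  have hit : ∀ n, T^[n] (x - y) = T^[n] x - y := by
    intro n
    induction n with
    | zero => rfl
    | succ n ih => rw [Function.iterate_succ_apply', ih, hsub, hTy, Function.iterate_succ_apply']
  rw [tendsto_iff_norm_sub_tendsto_zero]
  have hcl2 := tendsto_atTop_ciInf (hanti (x - y)) ⟨0, by rintro _ ⟨n, rfl⟩; exact norm_nonneg _⟩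
  have hz : Tendsto (fun n => ‖T^[φ n] (x - y)‖) atTop (nhds 0) := by
    simp only [hit]
    exact tendsto_iff_norm_sub_tendsto_zero.mp hy
  have := tendsto_nhds_unique hz (hcl2.comp hφ.tendsto_atTop)
  rw [← this] at hcl2
  simpa only [hit] using hcl2

lemma cptp_foldl {d : ℕ} (l : List (Matrix (Fin d) (Fin d) ℂ → Matrix (Fin d) (Fin d) ℂ))
    (h : ∀ f ∈ l, IsCPTP f) : IsCPTP (fun X => l.foldl (fun y f => f y) X) := by
  induction l with
  | nil => exact cptp_id
  | cons f l ih =>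
    exact cptp_comp (ih fun g hg => h g (List.mem_cons_of_mem _ hg)) (h f List.mem_cons_self)

lemma foldl_fixed {V : Type*} (l : List (V → V)) (X : V) (h : ∀ f ∈ l, f X = X) :
    l.foldl (fun y f => f y) X = X := by
  induction l with
  | nil => rfl
  | cons f l ih =>
    rw [List.foldl_cons, h f List.mem_cons_self]
    exact ih fun g hg => h g (List.mem_cons_of_mem _ hg)

lemma foldl_norm {V : Type*} (N : V → ℝ) (l : List (V → V))
    (hc : ∀ f ∈ l, ∀ X, N (f X) ≤ N X) (hs : ∀ f ∈ l, ∀ X, N (f X) = N X → f X = X) (X : V) :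
    N (l.foldl (fun y f => f y) X) ≤ N X ∧
    (N (l.foldl (fun y f => f y) X) = N X → ∀ f ∈ l, f X = X) := by
  induction l generalizing X with
  | nil => simp
  | cons f l ih =>
    rw [List.foldl_cons]
    obtain ⟨h1, h2⟩ := ih (fun g hg => hc g (List.mem_cons_of_mem _ hg))
      (fun g hg => hs g (List.mem_cons_of_mem _ hg)) (f X)
    have h3 := hc f List.mem_cons_self X
    refine ⟨h1.trans h3, fun h => ?_⟩
    have h4 : f X = X := hs f List.mem_cons_self X (le_antisymm h3 (h ▸ h1))
    have h5 := h2 (by rw [h, h4])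
    intro g hg
    rcases List.mem_cons.mp hg with rfl | hg
    · exact h4
    · rw [h4] at h5; exact h5 g hg

/-- Alternating projections for CPTP projections with a common positive-definite fixed
density matrix: the cyclic iterates `(E_r ∘ ⋯ ∘ E_1)ⁿ` converge pointwise to a CPTP
projection `Ê` whose fixed-point set and range both equal `⋂ i, fix(E i)`. -/
theorem alternating_cptp_projections_full_rank {d r : ℕ}
    (E : Fin r → (Matrix (Fin d) (Fin d) ℂ → Matrix (Fin d) (Fin d) ℂ))
    (hE : ∀ i, IsCPTP (E i)) (hproj : ∀ i X, E i (E i X) = E i X)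
    (ρ : Matrix (Fin d) (Fin d) ℂ) (hρ : ρ.PosDef) (hρtr : ρ.trace = 1)
    (hfix : ∀ i, E i ρ = ρ) :
    ∃ Ehat : Matrix (Fin d) (Fin d) ℂ → Matrix (Fin d) (Fin d) ℂ,
      (∀ X, Tendsto (fun n : ℕ => (cycleOf E)^[n] X) atTop (nhds (Ehat X))) ∧
      IsCPTP Ehat ∧
      (∀ X, Ehat (Ehat X) = Ehat X) ∧
      (∀ X, Ehat X = X ↔ ∀ i, E i X = X) ∧
      (∀ X, (∃ Y, Ehat Y = X) ↔ ∀ i, E i X = X) ∧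
      (∀ τ, IsDensity τ → ∀ i, E i (Ehat τ) = Ehat τ) := by
  obtain ⟨L, hL⟩ := exists_iso hρ
  have hc : ∀ i X, ‖L (E i X)‖ ≤ ‖L X‖ := fun i X => by
    refine le_of_sq_le_sq ?_ (norm_nonneg _)
    rw [hL, hL]
    exact contraction (hE i) hρ (hfix i) X
  have hs : ∀ i X, ‖L (E i X)‖ = ‖L X‖ → E i X = X := fun i X =>
    fixed_of_norm_eq L (E i) (cptp_add (hE i)) (hproj i) (cptp_smul (hE i)) (hc i) X
  set T := cycleOf E with hT
  have hTc : IsCPTP T := cptp_foldl _ (by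
    intro f hf; obtain ⟨i, rfl⟩ := (List.mem_ofFn' _ _).mp hf; exact hE i)
  have hTn := foldl_norm (fun X => ‖L X‖) (List.ofFn E)
    (by intro f hf; obtain ⟨i, rfl⟩ := (List.mem_ofFn' _ _).mp hf; exact hc i)
    (by intro f hf; obtain ⟨i, rfl⟩ := (List.mem_ofFn' _ _).mp hf; exact hs i)
  have hTs : ∀ X, ‖L (T X)‖ = ‖L X‖ → ∀ i, E i X = X := fun X h i =>
    (hTn X).2 h (E i) ((List.mem_ofFn' _ _).mpr ⟨i, rfl⟩)
  have hTf : ∀ X, (∀ i, E i X = X) → T X = X := fun X h => foldl_fixed _ _ (by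
    intro f hf; obtain ⟨i, rfl⟩ := (List.mem_ofFn' _ _).mp hf; exact h i)
  let TL : Matrix (Fin d) (Fin d) ℂ →ₗ[ℂ] Matrix (Fin d) (Fin d) ℂ :=
    { toFun := T, map_add' := cptp_add hTc, map_smul' := cptp_smul hTc }
  let TH : EuclideanSpace ℂ (Fin d × Fin d) →ₗ[ℂ] EuclideanSpace ℂ (Fin d × Fin d) :=
    L.toLinearMap ∘ₗ TL ∘ₗ L.symm.toLinearMap
  have hTH : ∀ v, TH v = L (T (L.symm v)) := fun v => rfl
  have hTHn : ∀ n X, TH^[n] (L X) = L (T^[n] X) := by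
    intro n X
    induction n with
    | zero => rfl
    | succ n ih =>
      rw [Function.iterate_succ_apply', ih, hTH, L.symm_apply_apply, Function.iterate_succ_apply']
  have hLc : Continuous L.symm := LinearMap.continuous_of_finiteDimensional L.symm.toLinearMap
  have hconv : ∀ X, ∃ Y, (∀ i, E i Y = Y) ∧ Tendsto (fun n : ℕ => T^[n] X) atTop (nhds Y) := by
    intro X
    obtain ⟨y, hy, hlim⟩ := tendsto_iterates TH (LinearMap.continuous_of_finiteDimensional TH)
      (map_sub TH) (fun v => by
        rw [hTH]
        have := (hTn (L.symm v)).1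
        simp only [L.apply_symm_apply] at this
        exact this) (fun v hv => by
        rw [hTH] at hv ⊢
        have : ‖L (T (L.symm v))‖ = ‖L (L.symm v)‖ := by rw [hv, L.apply_symm_apply]
        rw [hTf _ (hTs _ this), L.apply_symm_apply]) (L X)
    refine ⟨L.symm y, hTs _ ?_, ?_⟩
    · rw [← hTH, hy, L.apply_symm_apply]
    · refine ((hLc.tendsto y).comp hlim).congr fun n => ?_
      simp [hTHn]
  choose Ehat hfixhat hlim using hconv
  have hid : ∀ X, (∀ i, E i X = X) → Ehat X = X := fun X h =>
    tendsto_nhds_unique (hlim X) (by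
      simp only [Function.iterate_fixed (hTf X h)]; exact tendsto_const_nhds)
  have hiff : ∀ X, Ehat X = X ↔ ∀ i, E i X = X := fun X =>
    ⟨fun h => h ▸ hfixhat X, hid X⟩
  refine ⟨Ehat, hlim, ?_, fun X => hid _ (hfixhat X), hiff, fun X => ?_, fun τ _ => hfixhat τ⟩
  · have hn := fun n => cptp_iterate hTc n
    refine cptp_of_choi (fun X Y => ?_) (fun c X => ?_) (fun X => ?_) ?_
    · refine tendsto_nhds_unique (hlim _) (((hlim X).add (hlim Y)).congr fun n => ?_)
      exact (cptp_add (hn n) X Y).symm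
    · refine tendsto_nhds_unique (hlim _) (((hlim X).const_smul c).congr fun n => ?_)
      exact (cptp_smul (hn n) c X).symm
    · have h1 : Tendsto (fun n => (T^[n] X).trace) atTop (nhds (Ehat X).trace) :=
        ((continuous_id.matrix_trace).tendsto (Ehat X)).comp (hlim X)
      simp only [cptp_trace (hn _)] at h1
      exact tendsto_nhds_unique h1 tendsto_const_nhds |>.symm ▸ rfl
    · have hC : Tendsto (fun n => choiMat (T^[n])) atTop (nhds (choiMat Ehat)) := by
        refine tendsto_pi_nhds.mpr fun a => tendsto_pi_nhds.mpr fun b => ?_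
        exact tendsto_pi_nhds.mp (tendsto_pi_nhds.mp (hlim (Matrix.single a.2 b.2 1)) a.1) b.1
      refine Matrix.PosSemidef.of_dotProduct_mulVec_nonneg ?_ fun v => ?_
      · refine tendsto_nhds_unique ?_ hC
        refine ((continuous_id.matrix_conjTranspose.tendsto (choiMat Ehat)).comp hC).congr
          fun n => (cptp_choi (hn n)).isHermitian
      · have hcv : Continuous fun A : Matrix (Fin d × Fin d) (Fin d × Fin d) ℂ =>
            star v ⬝ᵥ (A *ᵥ v) := by fun_prop
        exact ge_of_tendsto' ((hcv.tendsto _).comp hC)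
          fun n => (cptp_choi (hn n)).dotProduct_mulVec_nonneg v
  · exact ⟨fun ⟨Y, h⟩ => h ▸ hfixhat Y, fun h => ⟨X, hid X h⟩⟩
end
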